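/- Electric quasigeodesics electrically track hyperbolic geodesics: for all δ ≥ 0, C ≥ 0, D > 0 and P ≥ 1 there exists K ≥ 0 such that the following holds. Let (X,d) be a δ-hyperbolic geodesic metric space and 𝓗 a collection of C-quasiconvex, D-separated subsets of X, with associated electric pseudometric d_e. Then for any x,y ∈ X, any electric P-quasigeodesic β from x to y and any geodesic γ of (X,d) from x to y, the image of β is contained in the K-neighborhood of γ with respect to the electric pseudometric d_e. -/

import Mathlib

open Metric Set

/-- `f` is a geodesic from `x` to `y`, parametrized by arc length on `[0, dist x y]`. -/
def IsGeodesicFrom {X : Type*} [MetricSpace X] (f : ℝ → X) (x y : X) : Prop :=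
  f 0 = x ∧ f (dist x y) = y ∧
    ∀ s ∈ Set.Icc (0 : ℝ) (dist x y), ∀ t ∈ Set.Icc (0 : ℝ) (dist x y),
      dist (f s) (f t) = |s - t|

/-- `X` is a geodesic metric space: any two points are joined by a geodesic. -/
def GeodesicSpace (X : Type*) [MetricSpace X] : Prop :=
  ∀ x y : X, ∃ f : ℝ → X, IsGeodesicFrom f x y

/-- Every geodesic triangle of `X` is `δ`-slim: each side lies in the `δ`-neighborhood
of the union of the other two sides. -/
def GromovHyperbolic (X : Type*) [MetricSpace X] (δ : ℝ) : Prop :=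
  ∀ x y z : X, ∀ f g h : ℝ → X,
    IsGeodesicFrom f x y → IsGeodesicFrom g y z → IsGeodesicFrom h x z →
    ∀ s ∈ Set.Icc (0 : ℝ) (dist x y),
      ∃ p ∈ g '' Set.Icc (0 : ℝ) (dist y z) ∪ h '' Set.Icc (0 : ℝ) (dist x z),
        dist (f s) p ≤ δ

/-- `A` is a `C`-quasiconvex subset: every geodesic segment with endpoints in `A`
lies in the `C`-neighborhood of `A`. -/
def QuasiconvexSet {X : Type*} [MetricSpace X] (C : ℝ) (A : Set X) : Prop :=
  ∀ x ∈ A, ∀ y ∈ A, ∀ f : ℝ → X, IsGeodesicFrom f x y →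
    ∀ s ∈ Set.Icc (0 : ℝ) (dist x y), ∃ a ∈ A, dist (f s) a ≤ C

/-- The collection `𝓗` is `D`-separated: distinct members are at distance at least `D`. -/
def SeparatedColl {X : Type*} [MetricSpace X] (D : ℝ) (𝓗 : Set (Set X)) : Prop :=
  ∀ A ∈ 𝓗, ∀ B ∈ 𝓗, A ≠ B → ∀ a ∈ A, ∀ b ∈ B, D ≤ dist a b

/-- The electric pseudometric obtained by electrocuting the members of `𝓗`:
the infimum of `∑ dist (p i) (q i)` over all chains `x = p 0, q 0, p 1, q 1, …, p n, q n = y`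
such that consecutive points `q i`, `p (i+1)` lie in a common member of `𝓗`. -/
noncomputable def elecDist {X : Type*} [MetricSpace X] (𝓗 : Set (Set X)) (x y : X) : ℝ :=
  sInf { r : ℝ | ∃ n : ℕ, ∃ p q : Fin (n + 1) → X,
    p 0 = x ∧ q (Fin.last n) = y ∧
    (∀ i : Fin n, ∃ A ∈ 𝓗, q i.castSucc ∈ A ∧ p i.succ ∈ A) ∧
    r = ∑ i, dist (p i) (q i) }

/-- `f` is a `(K, ε)`-quasigeodesic on the interval `I` with respect to the
distance function `d`. -/
def IsQuasigeodesicOn {X : Type*} (d : X → X → ℝ) (K ε : ℝ) (I : Set ℝ) (f : ℝ → X) : Prop :=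
  ∀ s ∈ I, ∀ t ∈ I,
    (1 / K) * |s - t| - ε ≤ d (f s) (f t) ∧ d (f s) (f t) ≤ K * |s - t| + ε

/-- `f` is without backtracking: for some `ε ≥ 0`, `f` never returns to the
`ε`-neighborhood of a member of `𝓗` after leaving it (the set of times spent in such a
neighborhood is convex). -/
def NoBacktracking {X : Type*} [MetricSpace X] (𝓗 : Set (Set X)) (I : Set ℝ) (f : ℝ → X) :
    Prop :=
  ∃ ε : ℝ, 0 ≤ ε ∧ ∀ A ∈ 𝓗, ∀ s ∈ I, ∀ t ∈ I, ∀ u ∈ I, s ≤ t → t ≤ u →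
    f s ∈ Metric.cthickening ε A → f u ∈ Metric.cthickening ε A →
    f t ∈ Metric.cthickening ε A

/-- `π` is a nearest-point projection of `X` onto `A`. -/
def IsNearestPointProj {X : Type*} [MetricSpace X] (A : Set X) (π : X → X) : Prop :=
  ∀ x : X, π x ∈ A ∧ ∀ a ∈ A, dist x (π x) ≤ dist x a

/-- The collection `𝓗` is mutually `k`-cobounded: any nearest-point projection of one
member onto another has image of diameter at most `k`. -/
def MutuallyCobounded {X : Type*} [MetricSpace X] (k : ℝ) (𝓗 : Set (Set X)) : Prop :=
  ∀ A ∈ 𝓗, ∀ B ∈ 𝓗, A ≠ B → ∀ π : X → X, IsNearestPointProj A π →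
    ∀ b₁ ∈ B, ∀ b₂ ∈ B, dist (π b₁) (π b₂) ≤ k

/-- The intrinsic path (pseudo)distance between `x` and `y` inside the subset `A`:
the infimum of lengths of paths from `x` to `y` staying in `A`. -/
noncomputable def pathDistIn {X : Type*} [MetricSpace X] (A : Set X) (x y : X) : ENNReal :=
  ⨅ (g : ℝ → X) (_ : g 0 = x) (_ : g 1 = y) (_ : ∀ t ∈ Set.Icc (0 : ℝ) 1, g t ∈ A),
    eVariationOn g (Set.Icc (0 : ℝ) 1)

/-- `[s, u]` is a maximal subsegment of the path `β` (defined on `I`) lying within `A`. -/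
def IsMaximalSubsegmentIn {X : Type*} [MetricSpace X] (A : Set X) (I : Set ℝ) (β : ℝ → X)
    (s u : ℝ) : Prop :=
  s ∈ I ∧ u ∈ I ∧ s ≤ u ∧ (∀ t ∈ Set.Icc s u ∩ I, β t ∈ A) ∧
    ∀ s' u', s' ∈ I → u' ∈ I → s' ≤ s → u ≤ u' → (∀ t ∈ Set.Icc s' u' ∩ I, β t ∈ A) →
      s' = s ∧ u' = u

/-- `βq` is the electro-ambient path associated to `β` (both defined on `I`): it agrees
with `β` away from the maximal subsegments of `β` lying within a member of `𝓗`, and along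
each such maximal subsegment it traces a geodesic of `(X, d)` joining its endpoints. -/
def IsElectroAmbientRep {X : Type*} [MetricSpace X] (𝓗 : Set (Set X)) (I : Set ℝ)
    (β βq : ℝ → X) : Prop :=
  (∀ t ∈ I, (¬ ∃ A ∈ 𝓗, ∃ s u, IsMaximalSubsegmentIn A I β s u ∧ t ∈ Set.Icc s u) →
      βq t = β t) ∧
  ∀ A ∈ 𝓗, ∀ s u, IsMaximalSubsegmentIn A I β s u →
    βq s = β s ∧ βq u = β u ∧
      ∃ g : ℝ → X, IsGeodesicFrom g (β s) (β u) ∧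
        βq '' (Set.Icc s u ∩ I) = g '' Set.Icc (0 : ℝ) (dist (β s) (β u))

/-- `γ`, defined on `[0, L]`, is a parametrization by arc length of the path `βq`
defined on `I`. -/
def IsArclengthParamOf {X : Type*} [MetricSpace X] (I : Set ℝ) (βq : ℝ → X) (L : ℝ)
    (γ : ℝ → X) : Prop :=
  ∃ σ : ℝ → ℝ, MonotoneOn σ (Set.Icc 0 L) ∧ σ '' Set.Icc 0 L = I ∧
    (∀ s ∈ Set.Icc (0 : ℝ) L, γ s = βq (σ s)) ∧
    ∀ s ∈ Set.Icc (0 : ℝ) L, eVariationOn γ (Set.Icc 0 s) = ENNReal.ofReal s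

/-- The electric length of the path `f` on `I`: the supremum over finite monotone samplings
of the sums of consecutive electric distances (travel inside members of `𝓗` is free). -/
noncomputable def elecLengthOn {X : Type*} [MetricSpace X] (𝓗 : Set (Set X)) (f : ℝ → X)
    (I : Set ℝ) : ENNReal :=
  ⨆ p : ℕ × { u : ℕ → ℝ // Monotone u ∧ ∀ i, u i ∈ I },
    ∑ i ∈ Finset.range p.1, ENNReal.ofReal (elecDist 𝓗 (f (p.2.1 i)) (f (p.2.1 (i + 1))))

/-- `γ`, defined on `I` and avoiding `⋃₀ 𝓗`, is an ambient `κ`-quasigeodesic: each of its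
subsegments has length at most `κ·L(A) + κ` for any rectifiable competitor path `A` with the
same endpoints avoiding `⋃₀ 𝓗`. -/
def IsAmbientQuasigeodesic {X : Type*} [MetricSpace X] (𝓗 : Set (Set X)) (κ : ℝ)
    (I : Set ℝ) (γ : ℝ → X) : Prop :=
  (∀ t ∈ I, γ t ∉ ⋃₀ 𝓗) ∧
  ∀ a b, a ∈ I → b ∈ I → a ≤ b →
    ∀ A : ℝ → X, A a = γ a → A b = γ b → (∀ t ∈ Set.Icc a b, A t ∉ ⋃₀ 𝓗) →
      eVariationOn A (Set.Icc a b) ≠ ⊤ →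
      eVariationOn γ (Set.Icc a b) ≤
        ENNReal.ofReal κ * eVariationOn A (Set.Icc a b) + ENNReal.ofReal κ

/-- `φ` is a `(K, ε)`-quasi-isometric embedding. -/
def IsQIEmbedding {Y₁ Y₂ : Type*} [MetricSpace Y₁] [MetricSpace Y₂] (K ε : ℝ)
    (φ : Y₁ → Y₂) : Prop :=
  ∀ y₁ y₂ : Y₁,
    (1 / K) * dist y₁ y₂ - ε ≤ dist (φ y₁) (φ y₂) ∧ dist (φ y₁) (φ y₂) ≤ K * dist y₁ y₂ + ε

section ElectricChains

variable {X : Type*} [MetricSpace X]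

/-- There is an electric chain from `x` to `y` of total cost `r`. -/
inductive ElecChain (𝓗 : Set (Set X)) : X → X → ℝ → Prop
  | walk (x y : X) : ElecChain 𝓗 x y (dist x y)
  | cons {p y : X} {r : ℝ} (x q : X) (A : Set X) (hA : A ∈ 𝓗) (hq : q ∈ A) (hp : p ∈ A)
      (h : ElecChain 𝓗 p y r) : ElecChain 𝓗 x y (dist x q + r)

theorem elecChain_of_fin {𝓗 : Set (Set X)} (n : ℕ) (p q : Fin (n + 1) → X)
    (h : ∀ i : Fin n, ∃ A ∈ 𝓗, q i.castSucc ∈ A ∧ p i.succ ∈ A) :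
    ElecChain 𝓗 (p 0) (q (Fin.last n)) (∑ i, dist (p i) (q i)) := by
  induction n with
  | zero => simpa using ElecChain.walk (p 0) (q 0)
  | succ n ih =>
    rw [Fin.sum_univ_succ]
    obtain ⟨A, hA, hq, hp⟩ := h 0
    have := ih (fun i => p i.succ) (fun i => q i.succ) (fun i => h i.succ)
    exact ElecChain.cons (p 0) (q 0) A hA hq hp this

theorem ElecChain.exists_fin {𝓗 : Set (Set X)} {x y : X} {r : ℝ} (h : ElecChain 𝓗 x y r) :
    ∃ n : ℕ, ∃ p q : Fin (n + 1) → X, p 0 = x ∧ q (Fin.last n) = y ∧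
      (∀ i : Fin n, ∃ A ∈ 𝓗, q i.castSucc ∈ A ∧ p i.succ ∈ A) ∧
      r = ∑ i, dist (p i) (q i) := by
  induction h with
  | walk x y => exact ⟨0, fun _ => x, fun _ => y, rfl, rfl, fun i => i.elim0, by simp⟩
  | @cons p y r x q A hA hq hp h ih =>
    obtain ⟨n, p', q', rfl, hy, hj, hr⟩ := ih
    refine ⟨n + 1, Fin.cons x p', Fin.cons q q', rfl, ?_, ?_, ?_⟩
    · rw [← Fin.succ_last, Fin.cons_succ, hy]
    · intro i
      refine Fin.cases ?_ (fun j => ?_) i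
      · exact ⟨A, hA, by simpa using hq, by simpa using hp⟩
      · simpa [← Fin.succ_castSucc] using hj j
    · rw [Fin.sum_univ_succ, hr]
      simp

theorem elecDist_eq_sInf (𝓗 : Set (Set X)) (x y : X) :
    elecDist 𝓗 x y = sInf {r | ElecChain 𝓗 x y r} := by
  unfold elecDist
  congr 1
  ext r
  constructor
  · rintro ⟨n, p, q, rfl, rfl, hj, rfl⟩
    exact elecChain_of_fin n p q hj
  · exact ElecChain.exists_fin

theorem ElecChain.nonneg {𝓗 : Set (Set X)} {x y : X} {r : ℝ} (h : ElecChain 𝓗 x y r) :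
    0 ≤ r := by
  induction h with
  | walk x y => exact dist_nonneg
  | cons x q A hA hq hp h ih => exact add_nonneg dist_nonneg ih

theorem ElecChain.dist_trans {𝓗 : Set (Set X)} {y z : X} {r : ℝ} (h : ElecChain 𝓗 y z r)
    (x : X) : ∃ r' ≤ dist x y + r, ElecChain 𝓗 x z r' := by
  cases h with
  | walk => exact ⟨_, dist_triangle x y z, .walk x z⟩
  | cons _ q A hA hq hp h =>
    exact ⟨_, by linarith [dist_triangle x y q], .cons x q A hA hq hp h⟩

theorem ElecChain.trans {𝓗 : Set (Set X)} {x y z : X} {r s : ℝ} (h : ElecChain 𝓗 x y r)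
    (h' : ElecChain 𝓗 y z s) : ∃ t ≤ r + s, ElecChain 𝓗 x z t := by
  induction h with
  | walk x y => exact h'.dist_trans x
  | cons x q A hA hq hp h ih =>
    obtain ⟨t, ht, hc⟩ := ih h'
    exact ⟨_, by linarith, .cons x q A hA hq hp hc⟩

theorem ElecChain.reverse {𝓗 : Set (Set X)} {x y : X} {r : ℝ} (h : ElecChain 𝓗 x y r) :
    ∃ s ≤ r, ElecChain 𝓗 y x s := by
  induction h with
  | walk x y => exact ⟨_, (dist_comm y x).le, .walk y x⟩
  | @cons p y r x q A hA hq hp h ih =>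
    obtain ⟨s, hs, hc⟩ := ih
    obtain ⟨t, ht, hc'⟩ := hc.trans (.cons p p A hA hp hq (.walk q x))
    rw [dist_self, dist_comm q x] at ht
    exact ⟨t, by linarith, hc'⟩

theorem ElecChain.elecDist_le {𝓗 : Set (Set X)} {x y : X} {r : ℝ} (h : ElecChain 𝓗 x y r) :
    elecDist 𝓗 x y ≤ r := by
  rw [elecDist_eq_sInf]
  exact csInf_le ⟨0, fun _ h => h.nonneg⟩ h

theorem exists_elecChain_lt {𝓗 : Set (Set X)} {x y : X} {r : ℝ} (h : elecDist 𝓗 x y < r) :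
    ∃ s < r, ElecChain 𝓗 x y s := by
  rw [elecDist_eq_sInf] at h
  obtain ⟨s, hs, hr⟩ := exists_lt_of_csInf_lt ⟨_, .walk x y⟩ h
  exact ⟨s, hr, hs⟩

theorem elecDist_nonneg (𝓗 : Set (Set X)) (x y : X) : 0 ≤ elecDist 𝓗 x y := by
  rw [elecDist_eq_sInf]
  exact Real.sInf_nonneg fun _ h => h.nonneg

theorem elecDist_le_dist (𝓗 : Set (Set X)) (x y : X) : elecDist 𝓗 x y ≤ dist x y :=
  (ElecChain.walk x y).elecDist_le

theorem elecDist_self (𝓗 : Set (Set X)) (x : X) : elecDist 𝓗 x x = 0 :=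
  le_antisymm ((elecDist_le_dist 𝓗 x x).trans (dist_self x).le) (elecDist_nonneg 𝓗 x x)

theorem elecDist_eq_zero_of_mem {𝓗 : Set (Set X)} {A : Set X} (hA : A ∈ 𝓗) {x y : X}
    (hx : x ∈ A) (hy : y ∈ A) : elecDist 𝓗 x y = 0 := by
  refine le_antisymm ?_ (elecDist_nonneg 𝓗 x y)
  simpa using (ElecChain.cons x x A hA hx hy (.walk y y)).elecDist_le

theorem elecDist_triangle (𝓗 : Set (Set X)) (x y z : X) :
    elecDist 𝓗 x z ≤ elecDist 𝓗 x y + elecDist 𝓗 y z := by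
  refine le_of_forall_pos_le_add fun ε hε => ?_
  obtain ⟨r, hr, h⟩ := exists_elecChain_lt (lt_add_of_pos_right (elecDist 𝓗 x y) (half_pos hε))
  obtain ⟨s, hs, h'⟩ := exists_elecChain_lt (lt_add_of_pos_right (elecDist 𝓗 y z) (half_pos hε))
  obtain ⟨t, ht, hc⟩ := h.trans h'
  linarith [hc.elecDist_le]

theorem elecDist_comm (𝓗 : Set (Set X)) (x y : X) : elecDist 𝓗 x y = elecDist 𝓗 y x := by
  have key : ∀ a b : X, elecDist 𝓗 a b ≤ elecDist 𝓗 b a := fun a b => by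
    refine le_of_forall_pos_le_add fun ε hε => ?_
    obtain ⟨r, hr, h⟩ := exists_elecChain_lt (lt_add_of_pos_right (elecDist 𝓗 b a) hε)
    obtain ⟨s, hs, h'⟩ := h.reverse
    linarith [h'.elecDist_le]
  exact le_antisymm (key x y) (key y x)

/-- There is an electric chain of cost `c` with `m` jumps from `q ∈ A` to `y` that begins
with a jump inside `A`. -/
inductive JumpChain (𝓗 : Set (Set X)) : Set X → X → X → ℝ → ℕ → Prop
  | last {A : Set X} (hA : A ∈ 𝓗) {q p : X} (hq : q ∈ A) (hp : p ∈ A) (y : X) :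
      JumpChain 𝓗 A q y (dist p y) 1
  | cons {A B : Set X} (hA : A ∈ 𝓗) {q p q' y : X} {c : ℝ} {m : ℕ} (hq : q ∈ A) (hp : p ∈ A)
      (h : JumpChain 𝓗 B q' y c m) : JumpChain 𝓗 A q y (dist p q' + c) (m + 1)

theorem JumpChain.mem {𝓗 : Set (Set X)} {A : Set X} {q y : X} {c : ℝ} {m : ℕ}
    (h : JumpChain 𝓗 A q y c m) : A ∈ 𝓗 ∧ q ∈ A := by
  cases h with
  | last hA hq hp => exact ⟨hA, hq⟩
  | cons hA hq hp h => exact ⟨hA, hq⟩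

theorem JumpChain.change_start {𝓗 : Set (Set X)} {A : Set X} {q q' y : X} {c : ℝ} {m : ℕ}
    (h : JumpChain 𝓗 A q y c m) (hq' : q' ∈ A) : JumpChain 𝓗 A q' y c m := by
  cases h with
  | last hA hq hp => exact .last hA hq' hp y
  | cons hA hq hp h => exact .cons hA hq' hp h

theorem JumpChain.cost_nonneg {𝓗 : Set (Set X)} {A : Set X} {q y : X} {c : ℝ} {m : ℕ}
    (h : JumpChain 𝓗 A q y c m) : 0 ≤ c := by
  induction h with
  | last => exact dist_nonneg
  | cons hA hq hp h ih => exact add_nonneg dist_nonneg ih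

/-- In a `D`-separated collection, merging consecutive jumps in the same member bounds the
number of jumps of an electric chain in terms of its cost. -/
theorem ElecChain.exists_jumpChain {𝓗 : Set (Set X)} {D : ℝ} (hD : SeparatedColl D 𝓗)
    {x y : X} {r : ℝ} (h : ElecChain 𝓗 x y r) :
    dist x y ≤ r ∨ ∃ A q c, ∃ m : ℕ, JumpChain 𝓗 A q y c m ∧ dist x q + c ≤ r ∧
      m * D ≤ D + c := by
  induction h with
  | walk x y => exact .inl le_rfl
  | @cons p y r x q A hA hq hp h ih =>
    right
    rcases ih with h | ⟨B, q', c, m, hJ, hc, hm⟩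
    · exact ⟨A, q, _, 1, .last hA hq hp y, by linarith, by
        push_cast; linarith [dist_nonneg (x := p) (y := y)]⟩
    · by_cases hAB : A = B
      · subst hAB
        exact ⟨A, q, c, m, hJ.change_start hq, by linarith [dist_nonneg (x := p) (y := q')], hm⟩
      · have := hD A hA B hJ.mem.1 hAB p hp q' hJ.mem.2
        exact ⟨A, q, _, m + 1, .cons hA hq hp hJ, by linarith, by push_cast; linarith⟩

theorem IsGeodesicFrom.reverse {f : ℝ → X} {x y : X} (h : IsGeodesicFrom f x y) :
    IsGeodesicFrom (fun t => f (dist x y - t)) y x := by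
  obtain ⟨h0, h1, h2⟩ := h
  refine ⟨by simpa using h1, by simpa [dist_comm y x] using h0, fun s hs t ht => ?_⟩
  rw [dist_comm y x] at hs ht
  rw [h2 _ ⟨by linarith [hs.2], by linarith [hs.1]⟩ _ ⟨by linarith [ht.2], by linarith [ht.1]⟩,
    abs_sub_comm]
  congr 1
  ring

theorem IsGeodesicFrom.subsegment {f : ℝ → X} {x y : X} (h : IsGeodesicFrom f x y) {a b : ℝ}
    (ha : 0 ≤ a) (hab : a ≤ b) (hb : b ≤ dist x y) :
    dist (f a) (f b) = b - a ∧ IsGeodesicFrom (fun t => f (a + t)) (f a) (f b) := by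
  have hd : dist (f a) (f b) = b - a := by
    rw [h.2.2 a ⟨ha, hab.trans hb⟩ b ⟨ha.trans hab, hb⟩, abs_sub_comm,
      abs_of_nonneg (sub_nonneg.2 hab)]
  refine ⟨hd, by simp, by simp [hd], fun s hs t ht => ?_⟩
  rw [hd] at hs ht
  rw [h.2.2 _ ⟨by linarith [hs.1], by linarith [hs.2]⟩ _ ⟨by linarith [ht.1], by linarith [ht.2]⟩]
  congr 1
  ring

/-- Both points, and all geodesics from the first to the second, lie in `S`. -/
def GeodesicsWithin (S : Set X) (a b : X) : Prop :=
  a ∈ S ∧ b ∈ S ∧ ∀ f : ℝ → X, IsGeodesicFrom f a b → ∀ t ∈ Set.Icc (0 : ℝ) (dist a b), f t ∈ S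

theorem GeodesicsWithin.symm {S : Set X} {a b : X} (h : GeodesicsWithin S a b) :
    GeodesicsWithin S b a := by
  refine ⟨h.2.1, h.1, fun f hf t ht => ?_⟩
  have := h.2.2 _ hf.reverse (dist b a - t)
    ⟨by linarith [ht.2], by linarith [ht.1, dist_comm a b]⟩
  simpa using this

theorem GeodesicsWithin.mono {S S' : Set X} (hS : S ⊆ S') {a b : X}
    (h : GeodesicsWithin S a b) : GeodesicsWithin S' a b :=
  ⟨hS h.1, hS h.2.1, fun f hf t ht => hS (h.2.2 f hf t ht)⟩

/-- `a` and `b` are joined by a broken geodesic with `n` pieces that lies in `S` for every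
choice of the pieces. -/
def BrokenGeodesic (S : Set X) : ℕ → X → X → Prop
  | 0, a, b => a = b ∧ a ∈ S
  | n + 1, a, b => ∃ c, GeodesicsWithin S a c ∧ BrokenGeodesic S n c b

theorem BrokenGeodesic.left_mem {S : Set X} {n : ℕ} {a b : X} (h : BrokenGeodesic S n a b) :
    a ∈ S := by
  cases n with
  | zero => exact h.2
  | succ n =>
    obtain ⟨c, hc, -⟩ := h
    exact hc.1

theorem BrokenGeodesic.trans {S : Set X} {m n : ℕ} {a b c : X} (h : BrokenGeodesic S m a b)
    (h' : BrokenGeodesic S n b c) : BrokenGeodesic S (m + n) a c := by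
  induction m generalizing a with
  | zero =>
    obtain ⟨rfl, -⟩ := h
    rwa [zero_add]
  | succ m ih =>
    obtain ⟨d, hd, h⟩ := h
    rw [Nat.add_right_comm]
    exact ⟨d, hd, ih h⟩

theorem BrokenGeodesic.split {S : Set X} {m n : ℕ} {a c : X}
    (h : BrokenGeodesic S (m + n) a c) :
    ∃ b, BrokenGeodesic S m a b ∧ BrokenGeodesic S n b c := by
  induction m generalizing a with
  | zero =>
    rw [zero_add] at h
    exact ⟨a, ⟨rfl, h.left_mem⟩, h⟩
  | succ m ih =>
    rw [Nat.add_right_comm] at h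
    obtain ⟨d, hd, h⟩ := h
    obtain ⟨b, hb, hb'⟩ := ih h
    exact ⟨b, ⟨d, hd, hb⟩, hb'⟩

theorem GeodesicsWithin.brokenGeodesic {S : Set X} {a b : X} (h : GeodesicsWithin S a b) :
    BrokenGeodesic S 1 a b :=
  ⟨b, h, rfl, h.2.1⟩

theorem BrokenGeodesic.symm {S : Set X} {n : ℕ} {a b : X} (h : BrokenGeodesic S n a b) :
    BrokenGeodesic S n b a := by
  induction n generalizing a with
  | zero =>
    obtain ⟨rfl, h⟩ := h
    exact ⟨rfl, h⟩
  | succ n ih =>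
    obtain ⟨c, hc, h⟩ := h
    exact (ih h).trans hc.symm.brokenGeodesic

theorem BrokenGeodesic.mono {S S' : Set X} (hS : S ⊆ S') {n : ℕ} {a b : X}
    (h : BrokenGeodesic S n a b) : BrokenGeodesic S' n a b := by
  induction n generalizing a with
  | zero => exact ⟨h.1, hS h.2⟩
  | succ n ih =>
    obtain ⟨c, hc, h⟩ := h
    exact ⟨c, hc.mono hS, ih h⟩

/-- In a `δ`-hyperbolic space a geodesic is logarithmically close to any broken geodesic with
the same endpoints. -/
theorem BrokenGeodesic.exists_dist_le {δ : ℝ} (hX : GeodesicSpace X)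
    (hδ : GromovHyperbolic X δ) {S : Set X} (k : ℕ) {n : ℕ} (hn : n ≤ 2 ^ k) {a b : X}
    (h : BrokenGeodesic S n a b) {f : ℝ → X} (hf : IsGeodesicFrom f a b) {t : ℝ}
    (ht : t ∈ Set.Icc (0 : ℝ) (dist a b)) : ∃ w ∈ S, dist (f t) w ≤ δ * k := by
  induction k generalizing n a b f t with
  | zero =>
    refine ⟨f t, ?_, by simp⟩
    obtain rfl | rfl : n = 0 ∨ n = 1 := by
      rw [pow_zero] at hn
      lia
    · obtain ⟨rfl, ha⟩ := h
      rw [dist_self] at ht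
      rwa [le_antisymm ht.2 ht.1, hf.1]
    · obtain ⟨c, hc, rfl, -⟩ := h
      exact hc.2.2 f hf t ht
  | succ k ih =>
    have hn' : n = n / 2 + (n - n / 2) := by lia
    rw [hn'] at h
    obtain ⟨c, h₁, h₂⟩ := h.split
    obtain ⟨g₁, hg₁⟩ := hX a c
    obtain ⟨g₂, hg₂⟩ := hX b c
    rw [pow_succ] at hn
    have hp : ∃ p, dist (f t) p ≤ δ ∧ ∃ w ∈ S, dist p w ≤ δ * k := by
      obtain ⟨p, ⟨s, hs, rfl⟩ | ⟨s, hs, rfl⟩, hp⟩ := hδ a b c f g₂ g₁ hf hg₂ hg₁ t ht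
      · exact ⟨_, hp, ih (by lia) h₂.symm hg₂ hs⟩
      · exact ⟨_, hp, ih (by lia) h₁ hg₁ hs⟩
    obtain ⟨p, hp, w, hw, hpw⟩ := hp
    refine ⟨w, hw, (dist_triangle _ p _).trans ?_⟩
    push_cast
    linarith

theorem geodesicsWithin_elecBall_of_dist_le {𝓗 : Set (Set X)} {x a b : X} {r : ℝ}
    (h : elecDist 𝓗 x a + dist a b ≤ r) : GeodesicsWithin {w | elecDist 𝓗 x w ≤ r} a b := by
  have key : ∀ w, dist a w ≤ dist a b → elecDist 𝓗 x w ≤ r := fun w hw => by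
    linarith [elecDist_triangle 𝓗 x a w, elecDist_le_dist 𝓗 a w]
  refine ⟨key a (by simp), key b le_rfl, fun f hf t ht => key _ ?_⟩
  have h0 : dist (f 0) (f t) = |0 - t| := hf.2.2 0 ⟨le_rfl, dist_nonneg⟩ t ht
  rw [hf.1, zero_sub, abs_neg, abs_of_nonneg ht.1] at h0
  linarith [ht.2]

theorem geodesicsWithin_elecBall_of_mem {𝓗 : Set (Set X)} {C : ℝ} (hC : 0 ≤ C) {A : Set X}
    (hA : A ∈ 𝓗) (hqc : QuasiconvexSet C A) {a b : X} (ha : a ∈ A) (hb : b ∈ A) :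
    GeodesicsWithin {w | elecDist 𝓗 a w ≤ C} a b := by
  refine ⟨(elecDist_self 𝓗 a).trans_le hC, (elecDist_eq_zero_of_mem hA ha hb).trans_le hC,
    fun f hf t ht => ?_⟩
  obtain ⟨c, hc, hd⟩ := hqc a ha b hb f hf t ht
  have := elecDist_triangle 𝓗 a c (f t)
  have h0 := elecDist_eq_zero_of_mem hA ha hc
  have := elecDist_le_dist 𝓗 c (f t)
  rw [dist_comm] at this
  change elecDist 𝓗 a (f t) ≤ C
  linarith

theorem elecBall_subset {𝓗 : Set (Set X)} {a b : X} {r s : ℝ} (h : elecDist 𝓗 a b + r ≤ s) :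
    {w | elecDist 𝓗 b w ≤ r} ⊆ {w | elecDist 𝓗 a w ≤ s} := fun w hw => by
  have : elecDist 𝓗 b w ≤ r := hw
  change elecDist 𝓗 a w ≤ s
  linarith [elecDist_triangle 𝓗 a b w]

theorem JumpChain.brokenGeodesic {𝓗 : Set (Set X)} {C : ℝ} (hC : 0 ≤ C)
    (hqc : ∀ A ∈ 𝓗, QuasiconvexSet C A) {A : Set X} {q y : X} {c : ℝ} {m : ℕ}
    (h : JumpChain 𝓗 A q y c m) :
    BrokenGeodesic {w | elecDist 𝓗 q w ≤ c + C} (m * 2) q y := by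
  induction h with
  | @last A hA q p hq hp y =>
    refine ⟨p, (geodesicsWithin_elecBall_of_mem hC hA (hqc A hA) hq hp).mono ?_,
      (geodesicsWithin_elecBall_of_dist_le ?_).brokenGeodesic⟩
    · intro w (hw : _ ≤ C)
      change _ ≤ dist p y + C
      linarith [dist_nonneg (x := p) (y := y)]
    · rw [elecDist_eq_zero_of_mem hA hq hp]
      linarith
  | @cons A B hA q p q' y c m hq hp h ih =>
    have h0 := elecDist_eq_zero_of_mem hA hq hp
    have hc := h.cost_nonneg
    rw [Nat.succ_mul]
    refine ⟨p, (geodesicsWithin_elecBall_of_mem hC hA (hqc A hA) hq hp).mono ?_, q',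
      geodesicsWithin_elecBall_of_dist_le ?_, ih.mono (elecBall_subset ?_)⟩
    · intro w (hw : _ ≤ C)
      change _ ≤ dist p q' + c + C
      linarith [dist_nonneg (x := p) (y := q')]
    · linarith
    · linarith [elecDist_le_dist 𝓗 p q', elecDist_triangle 𝓗 q p q', h.cost_nonneg]

/-- Points at small electric distance are joined by a broken geodesic with few pieces that stays
in an electric ball around its starting point. -/
theorem exists_brokenGeodesic_of_elecDist_lt {𝓗 : Set (Set X)} {C D : ℝ} (hC : 0 ≤ C)
    (hD : 0 < D) (hqc : ∀ A ∈ 𝓗, QuasiconvexSet C A) (hsep : SeparatedColl D 𝓗) {x y : X}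
    {r : ℝ} (h : elecDist 𝓗 x y < r) :
    ∃ n : ℕ, n ≤ 3 + 2 * r / D ∧ BrokenGeodesic {w | elecDist 𝓗 x w ≤ r + C} n x y := by
  have hr : 0 ≤ r := (elecDist_nonneg 𝓗 x y).trans h.le
  obtain ⟨s, hs, hchain⟩ := exists_elecChain_lt h
  rcases hchain.exists_jumpChain hsep with hd | ⟨A, q, c, m, hJ, hc, hm⟩
  · refine ⟨1, ?_, (geodesicsWithin_elecBall_of_dist_le ?_).brokenGeodesic⟩
    · have : 0 ≤ 2 * r / D := by positivity
      push_cast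
      linarith
    · rw [elecDist_self]
      linarith
  · have hc0 := hJ.cost_nonneg
    refine ⟨m * 2 + 1, ?_, q, geodesicsWithin_elecBall_of_dist_le ?_,
      (hJ.brokenGeodesic hC hqc).mono (elecBall_subset ?_)⟩
    · have : (m : ℝ) ≤ 1 + r / D := by
        rw [← sub_le_iff_le_add', le_div_iff₀ hD]
        linarith [dist_nonneg (x := x) (y := q)]
      push_cast
      rw [mul_div_assoc]
      linarith
    · rw [elecDist_self]
      linarith
    · linarith [elecDist_le_dist 𝓗 x q]

/-- An electric quasigeodesic is shadowed by broken geodesics whose number of pieces is linear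
in the parameter. -/
theorem exists_brokenGeodesic_of_isQuasigeodesicOn {𝓗 : Set (Set X)} {C D P T : ℝ} (hC : 0 ≤ C)
    (hD : 0 < D) (hP : 1 ≤ P) (hqc : ∀ A ∈ 𝓗, QuasiconvexSet C A) (hsep : SeparatedColl D 𝓗)
    {β : ℝ → X} (hβ : IsQuasigeodesicOn (elecDist 𝓗) P P (Set.Icc 0 T) β) (m : ℕ) {s t : ℝ}
    (hs : s ∈ Set.Icc 0 T) (ht : t ∈ Set.Icc 0 T) (hst : |s - t| ≤ m) :
    ∃ n : ℕ, n ≤ m * (3 + 2 * (2 * P + 1) / D) ∧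
      BrokenGeodesic {w | ∃ u ∈ Set.Icc 0 T, elecDist 𝓗 (β u) w ≤ 2 * P + 1 + C} n
        (β s) (β t) := by
  induction m generalizing s with
  | zero =>
    have : s = t := by
      rw [Nat.cast_zero] at hst
      exact sub_eq_zero.1 (abs_nonpos_iff.1 hst)
    subst this
    exact ⟨0, by simp, rfl, s, hs, by rw [elecDist_self]; linarith⟩
  | succ m ih =>
    have hm : (0 : ℝ) < m + 1 := by positivity
    push_cast at hst
    set l : ℝ := 1 / (m + 1) with hl
    have hl0 : 0 ≤ l := by positivity
    have hl1 : l ≤ 1 := by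
      rw [hl, div_le_one hm]
      linarith [(Nat.cast_nonneg m : (0 : ℝ) ≤ m)]
    have hlm : l * (m + 1) = 1 := by
      rw [hl]
      field_simp
    set s' : ℝ := s + l * (t - s) with hs'
    have hs'T : s' ∈ Set.Icc 0 T := by
      have := (convex_Icc 0 T).add_smul_sub_mem hs ht ⟨hl0, hl1⟩
      simpa using this
    have h1 : |s - s'| ≤ 1 := by
      have : s - s' = l * (s - t) := by
        rw [hs']
        ring
      rw [this, abs_mul, abs_of_nonneg hl0, ← hlm]
      gcongr
    have h2 : |s' - t| ≤ m := by
      have : s' - t = (1 - l) * (s - t) := by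
        rw [hs']
        ring
      rw [this, abs_mul, abs_of_nonneg (by linarith)]
      calc (1 - l) * |s - t| ≤ (1 - l) * (m + 1) := by
            gcongr
        _ = m := by linarith
    obtain ⟨n, hn, hB⟩ := ih hs'T h2
    have hlt : elecDist 𝓗 (β s) (β s') < 2 * P + 1 := by
      have := (hβ s hs s' hs'T).2
      nlinarith
    obtain ⟨n', hn', hB'⟩ := exists_brokenGeodesic_of_elecDist_lt hC hD hqc hsep hlt
    have hsub : {w | elecDist 𝓗 (β s) w ≤ 2 * P + 1 + C} ⊆
        {w | ∃ u ∈ Set.Icc 0 T, elecDist 𝓗 (β u) w ≤ 2 * P + 1 + C} :=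
      fun w hw => ⟨s, hs, hw⟩
    refine ⟨n' + n, ?_, (hB'.mono hsub).trans hB⟩
    push_cast
    linarith

theorem IsGeodesicFrom.continuousOn_elecDist {f : ℝ → X} {x y : X} (hf : IsGeodesicFrom f x y)
    (𝓗 : Set (Set X)) (p : X) :
    ContinuousOn (fun t => elecDist 𝓗 p (f t)) (Set.Icc 0 (dist x y)) := by
  refine (LipschitzOnWith.of_dist_le_mul (K := 1) fun s hs t ht => ?_).continuousOn
  have h := hf.2.2 s hs t ht
  rw [NNReal.coe_one, one_mul, Real.dist_eq, Real.dist_eq, ← h, abs_sub_le_iff]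
  have h1 := elecDist_triangle 𝓗 p (f t) (f s)
  have h2 := elecDist_triangle 𝓗 p (f s) (f t)
  have h3 := elecDist_le_dist 𝓗 (f s) (f t)
  rw [elecDist_comm 𝓗 (f t) (f s)] at h1
  constructor <;> linarith

/-- Along a geodesic that is electrically `r`-close to `β`, one can leave a point `p` at electric
distance more than `r - 1` from `β` towards an endpoint lying on `β`, and reach `β` by a broken
geodesic that stays electrically far from `p`. -/
theorem exists_brokenGeodesic_to_path {𝓗 : Set (Set X)} {C D T r : ℝ} (hC : 0 ≤ C)
    (hD : 0 < D) (hr : 0 ≤ r) (hqc : ∀ A ∈ 𝓗, QuasiconvexSet C A) (hsep : SeparatedColl D 𝓗)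
    {β f : ℝ → X} {x y : X} (hf : IsGeodesicFrom f x y)
    (hclose : ∀ a ∈ Set.Icc 0 (dist x y), ∃ t ∈ Set.Icc 0 T, elecDist 𝓗 (f a) (β t) ≤ r)
    {u e : ℝ} (hu : u ∈ Set.Icc 0 (dist x y)) (he : e ∈ Set.Icc 0 (dist x y))
    (hfar : ∀ t ∈ Set.Icc 0 T, r - 1 < elecDist 𝓗 (f u) (β t))
    (hend : ∃ t ∈ Set.Icc 0 T, β t = f e) :
    ∃ a ∈ Set.uIcc u e, ∃ t ∈ Set.Icc 0 T, ∃ n : ℕ, n ≤ 3 + 2 * (r + 1) / D ∧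
      BrokenGeodesic {w | r - 1 - C ≤ elecDist 𝓗 (f u) w} n (f a) (β t) ∧
      elecDist 𝓗 (f u) (f a) ≤ 2 * r ∧ elecDist 𝓗 (f a) (β t) ≤ r := by
  rcases le_total (2 * r) (elecDist 𝓗 (f u) (f e)) with h | h
  · have hsub : Set.uIcc u e ⊆ Set.Icc 0 (dist x y) := Set.uIcc_subset_Icc hu he
    have hmem : 2 * r ∈ Set.uIcc (elecDist 𝓗 (f u) (f u)) (elecDist 𝓗 (f u) (f e)) := by
      rw [elecDist_self]
      exact Set.mem_uIcc.2 (.inl ⟨by linarith, h⟩)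
    obtain ⟨a, ha, hau⟩ :=
      intermediate_value_uIcc ((hf.continuousOn_elecDist 𝓗 (f u)).mono hsub) hmem
    obtain ⟨t, ht, hat⟩ := hclose a (hsub ha)
    obtain ⟨n, hn, hB⟩ := exists_brokenGeodesic_of_elecDist_lt hC hD hqc hsep
      (show elecDist 𝓗 (f a) (β t) < r + 1 by linarith)
    refine ⟨a, ha, t, ht, n, hn, hB.mono fun w hw => ?_, hau.le, hat⟩
    rw [Set.mem_ofPred_eq] at hw ⊢
    have := elecDist_triangle 𝓗 (f u) w (f a)
    rw [elecDist_comm 𝓗 w] at this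
    dsimp only at hau
    linarith
  · obtain ⟨t, ht, hte⟩ := hend
    have := hfar t ht
    rw [hte] at this
    refine ⟨e, Set.right_mem_uIcc, t, ht, 0, ?_, ⟨hte.symm, ?_⟩, h, ?_⟩
    · have : 0 ≤ 2 * (r + 1) / D := by positivity
      push_cast
      linarith
    · change r - 1 - C ≤ _
      linarith
    · rwa [hte, elecDist_self]

end ElectricChains

theorem exists_linear_le_two_pow_of_large (a b c : ℝ) {δ : ℝ} (hδ : 0 ≤ δ) (ha : 0 ≤ a) :
    ∃ r₀ : ℝ, 0 ≤ r₀ ∧ ∀ r ≥ r₀, ∃ k : ℕ, a * r + b ≤ 2 ^ k ∧ δ * k < r - c := by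
  have hlim : Filter.Tendsto (fun k : ℕ => (a * ((δ + 1) * (k + 1) + c) + b) / (2 : ℝ) ^ k)
      Filter.atTop (nhds 0) := by
    have h1 := tendsto_pow_const_div_const_pow_of_one_lt 1 (one_lt_two (α := ℝ))
    have h0 := tendsto_pow_const_div_const_pow_of_one_lt 0 (one_lt_two (α := ℝ))
    have := (h1.const_mul (a * (δ + 1))).add (h0.const_mul (a * (δ + 1) + a * c + b))
    rw [mul_zero, mul_zero, add_zero] at this
    refine this.congr fun k => ?_
    ring
  obtain ⟨k₀, hk₀⟩ := Filter.eventually_atTop.1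
    (hlim.eventually (ge_mem_nhds (zero_lt_one (α := ℝ))))
  refine ⟨max 0 ((δ + 1) * (k₀ + 1) + c), le_max_left _ _, fun r hr => ?_⟩
  have hr' := (le_max_right _ _).trans hr
  have hδ1 : 0 < δ + 1 := by linarith
  have hk : (k₀ + 1 : ℝ) ≤ (r - c) / (δ + 1) := by
    rw [le_div_iff₀ hδ1]
    linarith
  have hle : k₀ + 1 ≤ ⌊(r - c) / (δ + 1)⌋₊ := Nat.le_floor (by exact_mod_cast hk)
  have hfl := Nat.floor_le ((by positivity : (0 : ℝ) ≤ k₀ + 1).trans hk)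
  have hlt := Nat.lt_floor_add_one ((r - c) / (δ + 1))
  set k := ⌊(r - c) / (δ + 1)⌋₊
  rw [le_div_iff₀ hδ1] at hfl
  rw [div_lt_iff₀ hδ1] at hlt
  refine ⟨k, ?_, ?_⟩
  · have := hk₀ k (by lia)
    rw [div_le_one (by positivity)] at this
    refine le_trans ?_ this
    gcongr
    linarith
  · have : (1 : ℝ) ≤ k := by exact_mod_cast (show 1 ≤ k by lia)
    linarith

/-- The geodesic lies in a uniform electric neighborhood of the electric quasigeodesic. -/
theorem exists_geodesic_subset_elec_neighborhood {δ C D P : ℝ} (hδ : 0 ≤ δ) (hC : 0 ≤ C)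
    (hD : 0 < D) (hP : 1 ≤ P) :
    ∃ R : ℝ, 0 ≤ R ∧ ∀ (X : Type*) [MetricSpace X], GeodesicSpace X → GromovHyperbolic X δ →
      ∀ 𝓗 : Set (Set X), (∀ A ∈ 𝓗, QuasiconvexSet C A) → SeparatedColl D 𝓗 →
        ∀ x y : X, ∀ T : ℝ, 0 ≤ T → ∀ β : ℝ → X, β 0 = x → β T = y →
          IsQuasigeodesicOn (elecDist 𝓗) P P (Set.Icc 0 T) β →
          ∀ f : ℝ → X, IsGeodesicFrom f x y → ∀ u ∈ Set.Icc 0 (dist x y),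
            ∃ t ∈ Set.Icc 0 T, elecDist 𝓗 (f u) (β t) ≤ R := by
  set N := 3 + 2 * (2 * P + 1) / D with hN
  have hN0 : 0 ≤ N := by positivity
  obtain ⟨r₀, hr₀, hlarge⟩ := exists_linear_le_two_pow_of_large (4 / D + 6 * P * N)
    (6 + 4 / D + (P * P + 1) * N) (1 + (2 * P + 1 + C)) hδ (by positivity)
  refine ⟨r₀, hr₀, fun X _ hX hhyp 𝓗 hqc hsep x y T hT β hβ0 hβT hβ f hf => ?_⟩
  have step : ∀ r ≥ r₀, (∀ u ∈ Set.Icc 0 (dist x y), ∃ t ∈ Set.Icc 0 T,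
      elecDist 𝓗 (f u) (β t) ≤ r) → ∀ u ∈ Set.Icc 0 (dist x y), ∃ t ∈ Set.Icc 0 T,
      elecDist 𝓗 (f u) (β t) ≤ r - 1 := by
    intro r hr hclose u hu
    by_contra! hfar
    have hr0 : 0 ≤ r := hr₀.trans hr
    obtain ⟨a, ha, s, hs, n₁, hn₁, hB₁, hau, has⟩ := exists_brokenGeodesic_to_path hC hD hr0 hqc
      hsep hf hclose hu ⟨le_rfl, dist_nonneg⟩ hfar ⟨0, ⟨le_rfl, hT⟩, by rw [hβ0, hf.1]⟩
    obtain ⟨b, hb, t, ht, n₂, hn₂, hB₂, hbu, hbt⟩ := exists_brokenGeodesic_to_path hC hD hr0 hqc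
      hsep hf hclose hu ⟨dist_nonneg, le_rfl⟩ hfar ⟨T, ⟨hT, le_rfl⟩, by rw [hβT, hf.2.1]⟩
    rw [Set.uIcc_of_ge hu.1] at ha
    rw [Set.uIcc_of_le hu.2] at hb
    have hst6 : elecDist 𝓗 (β s) (β t) ≤ 6 * r := by
      have h1 := elecDist_triangle 𝓗 (β s) (f a) (β t)
      have h2 := elecDist_triangle 𝓗 (f a) (f u) (β t)
      have h3 := elecDist_triangle 𝓗 (f u) (f b) (β t)
      rw [elecDist_comm 𝓗 (β s) (f a)] at h1
      rw [elecDist_comm 𝓗 (f a) (f u)] at h2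
      linarith
    have hst : |s - t| ≤ P * (6 * r + P) := by
      have := (hβ s hs t ht).1
      rw [one_div, inv_mul_eq_div, sub_le_iff_le_add, div_le_iff₀ (by linarith)] at this
      nlinarith
    obtain ⟨n₃, hn₃, hB₃⟩ := exists_brokenGeodesic_of_isQuasigeodesicOn hC hD hP hqc hsep hβ
      ⌈P * (6 * r + P)⌉₊ hs ht (hst.trans (Nat.le_ceil _))
    obtain ⟨k, hk, hδk⟩ := hlarge r hr
    have hS : {w | r - 1 - C ≤ elecDist 𝓗 (f u) w} ⊆
        {w | r - (1 + (2 * P + 1 + C)) ≤ elecDist 𝓗 (f u) w} := fun w hw => by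
      rw [Set.mem_ofPred_eq] at hw ⊢
      linarith
    have hS' : {w | ∃ v ∈ Set.Icc 0 T, elecDist 𝓗 (β v) w ≤ 2 * P + 1 + C} ⊆
        {w | r - (1 + (2 * P + 1 + C)) ≤ elecDist 𝓗 (f u) w} := fun w ⟨v, hv, hw⟩ => by
      rw [Set.mem_ofPred_eq]
      have := elecDist_triangle 𝓗 (f u) w (β v)
      rw [elecDist_comm 𝓗 w] at this
      linarith [hfar v hv]
    have hB := ((hB₁.mono hS).trans (hB₃.mono hS')).trans (hB₂.mono hS).symm
    have hcard : n₁ + n₃ + n₂ ≤ 2 ^ k := by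
      have hceil : (⌈P * (6 * r + P)⌉₊ : ℝ) ≤ P * (6 * r + P) + 1 :=
        (Nat.ceil_lt_add_one (by positivity)).le
      have h3 : (n₃ : ℝ) ≤ (P * (6 * r + P) + 1) * N :=
        hn₃.trans (mul_le_mul_of_nonneg_right hceil hN0)
      have : ((n₁ + n₃ + n₂ : ℕ) : ℝ) ≤ ((2 ^ k : ℕ) : ℝ) := by
        push_cast
        refine le_trans ?_ hk
        have : 2 * (3 + 2 * (r + 1) / D) + (P * (6 * r + P) + 1) * N =
          (4 / D + 6 * P * N) * r + (6 + 4 / D + (P * P + 1) * N) := by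
          ring
        linarith
      exact_mod_cast this
    obtain ⟨hab, hg⟩ := hf.subsegment ha.1 (ha.2.trans hb.1) hb.2
    obtain ⟨w, hw, hdw⟩ := hB.exists_dist_le hX hhyp k hcard hg (t := u - a)
      ⟨by linarith [ha.2], by linarith [hb.1]⟩
    rw [add_sub_cancel] at hdw
    have hw' : r - (1 + (2 * P + 1 + C)) ≤ elecDist 𝓗 (f u) w := hw
    linarith [elecDist_le_dist 𝓗 (f u) w]
  have descend : ∀ m : ℕ, (∀ u ∈ Set.Icc 0 (dist x y), ∃ t ∈ Set.Icc 0 T,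
      elecDist 𝓗 (f u) (β t) ≤ r₀ + m) → ∀ u ∈ Set.Icc 0 (dist x y), ∃ t ∈ Set.Icc 0 T,
      elecDist 𝓗 (f u) (β t) ≤ r₀ := by
    intro m
    induction m with
    | zero => simp
    | succ m ih =>
      intro h
      refine ih ?_
      have := step _ (by push_cast; linarith [(Nat.cast_nonneg m : (0 : ℝ) ≤ m)]) h
      simpa [← add_assoc] using this
  refine descend ⌈dist x y⌉₊ fun u hu => ⟨0, ⟨le_rfl, hT⟩, ?_⟩
  have h := hf.2.2 u hu 0 ⟨le_rfl, dist_nonneg⟩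
  rw [hf.1, sub_zero, abs_of_nonneg hu.1] at h
  rw [hβ0]
  linarith [elecDist_le_dist 𝓗 (f u) x, hu.2, Nat.le_ceil (dist x y)]

/-- Electric quasigeodesics electrically track hyperbolic geodesics:
for all `δ ≥ 0`, `C ≥ 0`, `D > 0`, `P ≥ 1` there exists `K ≥ 0` such that in any
`δ`-hyperbolic geodesic space with a collection `𝓗` of `C`-quasiconvex `D`-separated
subsets, any electric `P`-quasigeodesic from `x` to `y` lies in the electric
`K`-neighborhood of any geodesic of `(X,d)` from `x` to `y`. -/
theorem electric_quasigeodesics_track_geodesics :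
    ∀ δ C D P : ℝ, 0 ≤ δ → 0 ≤ C → 0 < D → 1 ≤ P →
      ∃ K : ℝ, 0 ≤ K ∧
        ∀ (X : Type) [MetricSpace X], GeodesicSpace X → GromovHyperbolic X δ →
          ∀ 𝓗 : Set (Set X), (∀ A ∈ 𝓗, QuasiconvexSet C A) → SeparatedColl D 𝓗 →
            ∀ x y : X, ∀ T : ℝ, 0 ≤ T → ∀ β : ℝ → X,
              β 0 = x → β T = y →
              IsQuasigeodesicOn (elecDist 𝓗) P P (Set.Icc 0 T) β →
              ∀ f : ℝ → X, IsGeodesicFrom f x y →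
                ∀ s ∈ Set.Icc (0 : ℝ) T,
                  ∃ t ∈ Set.Icc (0 : ℝ) (dist x y), elecDist 𝓗 (β s) (f t) ≤ K := by
  intro δ C D P hδ hC hD hP
  obtain ⟨R, hR, h⟩ := exists_geodesic_subset_elec_neighborhood hδ hC hD hP
  refine ⟨P * (P * (2 * R + 1 + P)) + P + R, by positivity, ?_⟩
  intro X _ hX hhyp 𝓗 hqc hsep x y T hT β hβ0 hβT hβ f hf s hs
  have hclose := h X hX hhyp 𝓗 hqc hsep x y T hT β hβ0 hβT hβ f hf
  set L := dist x y with hL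
  have hL0 : 0 ≤ L := dist_nonneg
  let U : Set ℝ := {u | u ∈ Set.Icc 0 L ∧ ∃ t ∈ Set.Icc 0 s, elecDist 𝓗 (f u) (β t) ≤ R}
  have hU0 : (0 : ℝ) ∈ U :=
    ⟨⟨le_rfl, hL0⟩, 0, ⟨le_rfl, hs.1⟩, by rwa [hf.1, hβ0, elecDist_self]⟩
  have hUbdd : BddAbove U := ⟨L, fun u hu => hu.1.2⟩
  obtain ⟨a, ⟨ha, t₁, ht₁, hat₁⟩, haU⟩ :=
    exists_lt_of_lt_csSup ⟨0, hU0⟩ (sub_one_lt (sSup U))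
  have hb : ∃ b ∈ Set.Icc 0 L, |a - b| ≤ 1 ∧ ∃ t ∈ Set.Icc s T, elecDist 𝓗 (f b) (β t) ≤ R := by
    rcases le_total (a + 1) L with hle | hle
    · have hmem : a + 1 ∈ Set.Icc 0 L := ⟨by linarith [ha.1], hle⟩
      refine ⟨a + 1, hmem, by simp, ?_⟩
      obtain ⟨t, ht, hbt⟩ := hclose (a + 1) hmem
      refine ⟨t, ⟨?_, ht.2⟩, hbt⟩
      by_contra! hts
      have := le_csSup hUbdd (show a + 1 ∈ U from ⟨hmem, t, ⟨ht.1, hts.le⟩, hbt⟩)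
      linarith
    · refine ⟨L, ⟨hL0, le_rfl⟩, abs_le.2 ⟨by linarith, by linarith [ha.2]⟩, T, ⟨hs.2, le_rfl⟩, ?_⟩
      rwa [hf.2.1, hβT, elecDist_self]
  obtain ⟨b, hb, hab, t₂, ht₂, hbt₂⟩ := hb
  have ht₁T : t₁ ∈ Set.Icc 0 T := ⟨ht₁.1, ht₁.2.trans hs.2⟩
  have ht₂T : t₂ ∈ Set.Icc 0 T := ⟨hs.1.trans ht₂.1, ht₂.2⟩
  have h12 : elecDist 𝓗 (β t₁) (β t₂) ≤ 2 * R + 1 := by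
    have h1 := elecDist_triangle 𝓗 (β t₁) (f a) (β t₂)
    have h2 := elecDist_triangle 𝓗 (f a) (f b) (β t₂)
    have h3 := elecDist_le_dist 𝓗 (f a) (f b)
    rw [hf.2.2 a ha b hb] at h3
    rw [elecDist_comm 𝓗 (β t₁) (f a)] at h1
    linarith
  have hlen : |t₁ - t₂| ≤ P * (2 * R + 1 + P) := by
    have := (hβ t₁ ht₁T t₂ ht₂T).1
    rw [one_div, inv_mul_eq_div, sub_le_iff_le_add, div_le_iff₀ (by linarith)] at this
    nlinarith
  have hst₁ : |s - t₁| ≤ P * (2 * R + 1 + P) := by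
    refine le_trans ?_ hlen
    rw [abs_of_nonneg (by linarith [ht₁.2]), abs_of_nonpos (by linarith [ht₁.2, ht₂.1])]
    linarith [ht₂.1]
  refine ⟨a, ha, ?_⟩
  have h1 := elecDist_triangle 𝓗 (β s) (β t₁) (f a)
  rw [elecDist_comm 𝓗 (β t₁)] at h1
  have h2 := (hβ s hs t₁ ht₁T).2
  have h3 : P * |s - t₁| ≤ P * (P * (2 * R + 1 + P)) := by gcongr
  linarith
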